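/- Let X be a metric space with distance d, let I ⊆ ℝ be a nonempty closed interval, let L : I → X be an isometric embedding (d(L(s), L(t)) = |s − t| for all s, t ∈ I), and write ℓ = L(I) for its image. Suppose there exist constants b₀, b₁, b₂ ≥ 0 and a map p : X → I such that: (i) d(x, L(p(x))) ≤ infDist(x, ℓ) + b₀ for every x ∈ X, and (ii) whenever x, y ∈ X satisfy infDist(x, ℓ) > b₁ and d(x, y) ≤ infDist(x, ℓ) − b₁, one has |p(x) − p(y)| ≤ b₂. Then for every K ≥ 1 there exists a constant B, depending only on K, b₀, b₁, b₂, with the following property: for every T ≥ 0 and every map γ : [0, T] → X satisfying d(γ(s), γ(t)) ≤ |s − t| ≤ K·d(γ(s), γ(t)) for all s, t ∈ [0, T], and with γ(0) ∈ ℓ and γ(T) ∈ ℓ, one has infDist(γ(t), ℓ) ≤ B for all t ∈ [0, T]. -/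

import Mathlib

lemma step_aux (f : ℝ → ℝ) (c h b : ℝ) (hh : 0 < h) (hb : 0 ≤ b) (n : ℕ) :
    ∀ s₀ : ℝ, s₀ ≤ c → c - s₀ ≤ n * h →
    (∀ s, s₀ ≤ s → s < c → ∀ t, s ≤ t → t ≤ c → t - s ≤ h → |f s - f t| ≤ b) →
    |f s₀ - f c| ≤ n * b := by
  induction n with
  | zero =>
    intro s₀ h1 h2 _
    have : s₀ = c := by
      simp at h2
      linarith
    subst this
    simp
  | succ n ih =>
    intro s₀ h1 h2 H
    push_cast at h2 ⊢
    have hnb : 0 ≤ (n : ℝ) * b := by positivity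
    rcases h1.eq_or_lt with rfl | h1
    · simp only [sub_self, abs_zero]
      linarith
    by_cases hc : s₀ + h ≤ c
    · have i1 := ih (s₀ + h) hc (by linarith) (fun s hs => H s (by linarith))
      have i2 := H s₀ le_rfl h1 (s₀ + h) (by linarith) hc (by linarith)
      have := abs_sub_le (f s₀) (f (s₀ + h)) (f c)
      linarith
    · have := H s₀ le_rfl h1 c h1.le le_rfl (by linarith)
      linarith

lemma step_bound (f : ℝ → ℝ) (s₀ c h b : ℝ) (hh : 0 < h) (hb : 0 ≤ b) (h1 : s₀ ≤ c)
    (H : ∀ s, s₀ ≤ s → s < c → ∀ t, s ≤ t → t ≤ c → t - s ≤ h → |f s - f t| ≤ b) :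
    |f s₀ - f c| ≤ (c - s₀) * (b / h) + b := by
  have h0 : 0 ≤ (c - s₀) / h := div_nonneg (by linarith) hh.le
  have h2 := Nat.le_ceil ((c - s₀) / h)
  have h3 := (Nat.ceil_lt_add_one h0).le
  have h4 := step_aux f c h b hh hb _ s₀ h1 ((div_le_iff₀ hh).1 h2) H
  have h5 := mul_le_mul_of_nonneg_right h3 hb
  have h6 : ((c - s₀) / h + 1) * b = (c - s₀) * (b / h) + b := by ring
  linarith

/-- Stability of quasi-geodesics. Given constants
`b₀, b₁, b₂ ≥ 0` and `K ≥ 1`, there is a constant `B` (depending only on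
`K, b₀, b₁, b₂`) such that: in any metric space `X`, for any isometrically
embedded nonempty closed interval `L : I → X` with image `ℓ = L '' I`,
any coarse closest-point projection `p : X → I` (property (i)) satisfying the
contraction-at-a-distance property (ii), and any `K`-quasi-geodesic
`γ : [0,T] → X` parametrized by arclength with endpoints on `ℓ`, the whole
path `γ` stays within `infDist`-distance `B` of `ℓ`. -/
theorem stability_of_quasigeodesics.{u} (b₀ b₁ b₂ : ℝ)
    (hb₀ : 0 ≤ b₀) (hb₁ : 0 ≤ b₁) (hb₂ : 0 ≤ b₂)
    (K : ℝ) (hK : 1 ≤ K) :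
    ∃ B : ℝ, ∀ (X : Type u) [MetricSpace X] (I : Set ℝ),
      I.Nonempty → IsClosed I → I.OrdConnected →
      ∀ (L : ℝ → X), (∀ s ∈ I, ∀ t ∈ I, dist (L s) (L t) = |s - t|) →
      ∀ (p : X → ℝ), (∀ x, p x ∈ I) →
      (∀ x : X, dist x (L (p x)) ≤ Metric.infDist x (L '' I) + b₀) →
      (∀ x y : X, b₁ < Metric.infDist x (L '' I) →
        dist x y ≤ Metric.infDist x (L '' I) - b₁ → |p x - p y| ≤ b₂) →
      ∀ T : ℝ, 0 ≤ T → ∀ γ : ℝ → X,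
        (∀ s ∈ Set.Icc (0 : ℝ) T, ∀ t ∈ Set.Icc (0 : ℝ) T,
          dist (γ s) (γ t) ≤ |s - t| ∧ |s - t| ≤ K * dist (γ s) (γ t)) →
        γ 0 ∈ L '' I → γ T ∈ L '' I →
        ∀ t ∈ Set.Icc (0 : ℝ) T, Metric.infDist (γ t) (L '' I) ≤ B := by
  obtain ⟨h, hh⟩ : ∃ h, h = 2 * K * b₂ + 1 := ⟨_, rfl⟩
  have hKb : 0 ≤ K * b₂ := by positivity
  have hpos : 0 < h := by linarith
  obtain ⟨R, hR⟩ : ∃ R, R = b₁ + h := ⟨_, rfl⟩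
  refine ⟨R + 2 * (K * (2 * (R + b₀) + 2 * b₂)), ?_⟩
  intro X _ I hI _ _ L hL p hpI hp hcon T hT γ hγ h0 hT' t ht
  set D : ℝ → ℝ := fun s => Metric.infDist (γ s) (L '' I) with hD
  change D t ≤ _
  have hMnn : 0 ≤ K * (2 * (R + b₀) + 2 * b₂) := by
    apply mul_nonneg <;> linarith
  by_cases htR : D t ≤ R
  · linarith
  push Not at htR
  have hlip : ∀ s ∈ Set.Icc (0 : ℝ) T, ∀ u ∈ Set.Icc (0 : ℝ) T, D s ≤ D u + |s - u| := by
    intro s hs u hu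
    have h1 : D s ≤ D u + dist (γ s) (γ u) := Metric.infDist_le_infDist_add_dist
    linarith [(hγ s hs u hu).1]
  have hγc : ContinuousOn γ (Set.Icc 0 T) := by
    have : LipschitzOnWith 1 γ (Set.Icc 0 T) := by
      apply LipschitzOnWith.of_dist_le_mul
      intro s hs u hu
      simpa [Real.dist_eq] using (hγ s hs u hu).1
    exact this.continuousOn
  have hDc : ContinuousOn D (Set.Icc 0 T) :=
    (Metric.continuous_infDist_pt _).comp_continuousOn hγc
  have hcomp : ∀ u v : ℝ, 0 ≤ u → v ≤ T → IsCompact (Set.Icc u v ∩ D ⁻¹' Set.Iic R) := by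
    intro u v hu hv
    exact isCompact_Icc.of_isClosed_subset
      ((hDc.mono (Set.Icc_subset_Icc hu hv)).preimage_isClosed_of_isClosed isClosed_Icc isClosed_Iic)
      Set.inter_subset_left
  have hRnn : 0 ≤ R := by linarith
  have hD0 : D 0 ≤ R := by
    simp only [hD]
    rwa [Metric.infDist_zero_of_mem h0]
  have hDT : D T ≤ R := by
    simp only [hD]
    rwa [Metric.infDist_zero_of_mem hT']
  obtain ⟨a, ⟨⟨ha0, hat⟩, haR⟩, hamax⟩ :=
    (hcomp 0 t le_rfl ht.2).exists_isGreatest ⟨0, ⟨le_rfl, ht.1⟩, hD0⟩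
  obtain ⟨c, ⟨⟨htc, hcT⟩, hcR⟩, hcmin⟩ :=
    (hcomp t T ht.1 le_rfl).exists_isLeast ⟨T, ⟨ht.2, le_rfl⟩, hDT⟩
  change D a ≤ R at haR
  change D c ≤ R at hcR
  have hbig : ∀ s, a < s → s < c → R < D s := by
    intro s h1 h2
    by_contra hcon'
    push Not at hcon'
    rcases le_total s t with h3 | h3
    · have := hamax ⟨⟨by linarith, h3⟩, hcon'⟩
      linarith
    · have := hcmin ⟨⟨h3, by linarith⟩, hcon'⟩
      linarith
  have hstep : ∀ s, a < s → s < c → ∀ u, a ≤ u → u ≤ c → |s - u| ≤ h →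
      |p (γ s) - p (γ u)| ≤ b₂ := by
    intro s h1 h2 u h3 h4 h5
    have h6 := hbig s h1 h2
    have h7 := (hγ s ⟨by linarith, by linarith⟩ u ⟨by linarith, by linarith⟩).1
    simp only [hD] at h6
    exact hcon _ _ (by linarith) (by linarith)
  have hat' : a < t := lt_of_le_of_ne hat (by rintro rfl; linarith)
  have htc' : t < c := lt_of_le_of_ne htc (by rintro rfl; linarith)
  have e1 := step_bound (fun s => p (γ s)) t c h b₂ hpos hb₂ htc (by
    intro s h1 h2 u h3 h4 h5
    exact hstep s (by linarith) h2 u (by linarith) h4 (by rw [abs_le]; constructor <;> linarith))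
  have e2 := step_bound (fun s => p (γ (-s))) (-t) (-a) h b₂ hpos hb₂ (by linarith) (by
    intro s h1 h2 u h3 h4 h5
    exact hstep (-s) (by linarith) (by linarith) (-u) (by linarith) (by linarith)
      (by rw [abs_le]; constructor <;> linarith))
  simp only [neg_neg] at e2
  have haI : a ∈ Set.Icc 0 T := ⟨ha0, by linarith⟩
  have hcI : c ∈ Set.Icc 0 T := ⟨by linarith, hcT⟩
  have e3 : |p (γ a) - p (γ c)| ≤ (c - a) * (b₂ / h) + 2 * b₂ := by
    have := abs_sub_le (p (γ a)) (p (γ t)) (p (γ c))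
    rw [abs_sub_comm (p (γ a))  (p (γ t))] at this
    have e : (c - a) * (b₂ / h) = (c - t) * (b₂ / h) + (-a - -t) * (b₂ / h) := by ring
    linarith
  have e4 : dist (γ a) (γ c) ≤ 2 * (R + b₀) + |p (γ a) - p (γ c)| := by
    have k1 := hp (γ a)
    have k2 := hp (γ c)
    have k3 := hL _ (hpI (γ a)) _ (hpI (γ c))
    have k4 := dist_triangle4 (γ a) (L (p (γ a))) (L (p (γ c))) (γ c)
    rw [dist_comm (L (p (γ c))) (γ c)] at k4
    simp only [hD] at haR hcR
    linarith
  have e5 := (hγ a haI c hcI).2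
  have e6 : c - a ≤ |a - c| := by
    rw [abs_sub_comm]
    exact le_abs_self _
  have e7 : K * (b₂ / h) ≤ 1 / 2 := by
    rw [← mul_div_assoc, div_le_iff₀ hpos]
    linarith
  have e8 : K * dist (γ a) (γ c) ≤ K * (2 * (R + b₀) + ((c - a) * (b₂ / h) + 2 * b₂)) :=
    mul_le_mul_of_nonneg_left (by linarith) (by linarith)
  have e9 : (c - a) * (K * (b₂ / h)) ≤ (c - a) * (1 / 2) :=
    mul_le_mul_of_nonneg_left e7 (by linarith)
  have e10 : K * (2 * (R + b₀) + ((c - a) * (b₂ / h) + 2 * b₂))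
    = K * (2 * (R + b₀) + 2 * b₂) + (c - a) * (K * (b₂ / h)) := by ring
  have e11 := hlip t ht a haI
  rw [abs_of_pos (by linarith)] at e11
  linarith
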